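/- Untestability of self-masking-type independencies (Theorem 4): let X, Z be nonempty finite types (partially observed variables with missingness indicators R_X, R_Z) and W a nonempty finite type (a fully observed variable). For every probability measure Q on Option X × Option Z × W × Bool × Bool (coordinates X*, Z*, W, R_X, R_Z) such that Q-almost surely X* = none if and only if R_X = 1 and Z* = none if and only if R_Z = 1, and such that Q assigns positive probability to every point consistent with these two constraints, there exists a probability measure P on X × Z × W × Bool × Bool (coordinates X, Z, W, R_X, R_Z) under which X is conditionally independent of R_X given (Z, W, R_Z), and whose pushforward under the masking map (x, z, w, r_x, r_z) ↦ ((if r_x = 0 then some x else none), (if r_z = 0 then some z else none), w, r_x, r_z) equals Q. Hence the conditional independence X ⟂ R_X | (Z, W, R_Z) has no testable implications for the observed-data distribution. -/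

import Mathlib

open MeasureTheory

/-- Elementary conditional probability `P(A | B)`. -/
noncomputable def cpr {Ω : Type*} [MeasurableSpace Ω] (P : Measure Ω) (A B : Set Ω) : ENNReal :=
  P (A ∩ B) / P B

/-- Discrete σ-algebra on `Option α`. -/
instance {α : Type*} : MeasurableSpace (Option α) := ⊤

/-- The masking map for two partially observed variables: coordinates
`(x, z, w, r_x, r_z) ↦ ((if r_x = 0 then some x else none),
(if r_z = 0 then some z else none), w, r_x, r_z)`. -/
def mask2 {X Z W : Type*} (p : X × Z × W × Bool × Bool) :
    Option X × Option Z × W × Bool × Bool :=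
  ((if p.2.2.2.1 = false then some p.1 else none),
    (if p.2.2.2.2 = false then some p.2.1 else none), p.2.2.1, p.2.2.2.1, p.2.2.2.2)

open scoped ENNReal in
/-- The measure with point masses `f` on a finite type. -/
noncomputable def massMeasure {Ω : Type*} [MeasurableSpace Ω] [Fintype Ω] (f : Ω → ℝ≥0∞) :
    Measure Ω :=
  ∑ p, f p • Measure.dirac p

open scoped ENNReal Classical in
theorem massMeasure_apply {Ω : Type*} [MeasurableSpace Ω] [Fintype Ω]
    [MeasurableSingletonClass Ω] (f : Ω → ℝ≥0∞) (s : Set Ω) :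
    massMeasure f s = ∑ p, if p ∈ s then f p else 0 := by
  simp [massMeasure, Measure.finsetSum_apply, Set.indicator_apply]

open scoped ENNReal in
theorem div_mul_eq_div_mul_div {a b A B : ℝ≥0∞} (ha : a ≤ A) (hb : b ≤ B)
    (hA : A ≠ ∞) (hB : B ≠ ∞) :
    a * b / (A * B) = a * B / (A * B) * (A * b / (A * B)) := by
  rcases eq_or_ne A 0 with rfl | hA0
  · simp [nonpos_iff_eq_zero.mp ha]
  rcases eq_or_ne B 0 with rfl | hB0
  · simp [nonpos_iff_eq_zero.mp hb]
  rw [ENNReal.mul_div_mul_right _ _ hB0 hB, ENNReal.mul_div_mul_left _ _ hA0 hA,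
    div_eq_mul_inv, div_eq_mul_inv, div_eq_mul_inv,
    ENNReal.mul_inv (Or.inl hA0) (Or.inl hA), mul_mul_mul_comm]

open scoped ENNReal in
/-- If the point masses factor as `α x * β r_x` for each value `(z, w, r_z)`, then `X` and `R_X`
are conditionally independent given `(Z, W, R_Z)`. -/
theorem cpr_inter_massMeasure {X Z W : Type*} [Fintype X] [Fintype Z] [Fintype W]
    [MeasurableSpace X] [MeasurableSingletonClass X]
    [MeasurableSpace Z] [MeasurableSingletonClass Z]
    [MeasurableSpace W] [MeasurableSingletonClass W]
    (α : Z × W × Bool → X → ℝ≥0∞) (β : Z × W × Bool → Bool → ℝ≥0∞)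
    (hα : ∀ c x, α c x ≠ ∞) (hβ : ∀ c r, β c r ≠ ∞) (x : X) (rx : Bool) (z : Z) (w : W)
    (rz : Bool) :
    let P : Measure (X × Z × W × Bool × Bool) := massMeasure fun p =>
      α (p.2.1, p.2.2.1, p.2.2.2.2) p.1 * β (p.2.1, p.2.2.1, p.2.2.2.2) p.2.2.2.1
    cpr P ({p | p.1 = x} ∩ {p | p.2.2.2.1 = rx})
        {p | p.2.1 = z ∧ p.2.2.1 = w ∧ p.2.2.2.2 = rz} =
      cpr P {p | p.1 = x} {p | p.2.1 = z ∧ p.2.2.1 = w ∧ p.2.2.2.2 = rz} *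
        cpr P {p | p.2.2.2.1 = rx} {p | p.2.1 = z ∧ p.2.2.1 = w ∧ p.2.2.2.2 = rz} := by
  classical
  intro P
  have hxr : P (({p | p.1 = x} ∩ {p | p.2.2.2.1 = rx}) ∩
      {p | p.2.1 = z ∧ p.2.2.1 = w ∧ p.2.2.2.2 = rz}) = α (z, w, rz) x * β (z, w, rz) rx := by
    simp only [P, massMeasure_apply, Fintype.sum_prod_type, Set.mem_inter_iff, Set.mem_ofPred_eq,
      ite_and, Finset.sum_ite_irrel, Finset.sum_ite_eq', Finset.sum_const_zero,
      Finset.mem_univ, if_true]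
  have hx : P ({p | p.1 = x} ∩ {p | p.2.1 = z ∧ p.2.2.1 = w ∧ p.2.2.2.2 = rz}) =
      α (z, w, rz) x * ∑ r, β (z, w, rz) r := by
    simp only [P, massMeasure_apply, Fintype.sum_prod_type, Set.mem_inter_iff, Set.mem_ofPred_eq,
      ite_and, Finset.sum_ite_irrel, Finset.sum_ite_eq', Finset.sum_const_zero,
      Finset.mem_univ, if_true, Finset.mul_sum]
  have hr : P ({p | p.2.2.2.1 = rx} ∩ {p | p.2.1 = z ∧ p.2.2.1 = w ∧ p.2.2.2.2 = rz}) =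
      (∑ x, α (z, w, rz) x) * β (z, w, rz) rx := by
    simp only [P, massMeasure_apply, Fintype.sum_prod_type, Set.mem_inter_iff, Set.mem_ofPred_eq,
      ite_and, Finset.sum_ite_irrel, Finset.sum_ite_eq', Finset.sum_const_zero,
      Finset.mem_univ, if_true, Finset.sum_mul]
  have hc : P {p | p.2.1 = z ∧ p.2.2.1 = w ∧ p.2.2.2.2 = rz} =
      (∑ x, α (z, w, rz) x) * ∑ r, β (z, w, rz) r := by
    simp only [P, massMeasure_apply, Fintype.sum_prod_type, Set.mem_ofPred_eq,
      ite_and, Finset.sum_ite_irrel, Finset.sum_ite_eq', Finset.sum_const_zero,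
      Finset.mem_univ, if_true, Finset.sum_mul_sum]
  simp only [cpr, hxr, hx, hr, hc]
  exact div_mul_eq_div_mul_div (Finset.single_le_sum (fun _ _ => zero_le) (Finset.mem_univ x))
    (Finset.single_le_sum (fun _ _ => zero_le) (Finset.mem_univ rx))
    (ENNReal.sum_ne_top.2 fun x _ => hα _ x) (ENNReal.sum_ne_top.2 fun r _ => hβ _ r)

/-- **Untestability of self-masking-type independencies (Theorem 4).**
For every observed-data distribution `Q` on `X* × Z* × W × R_X × R_Z` that is consistent
with the masking (a.s. `X* = none ↔ R_X = 1`, `Z* = none ↔ R_Z = 1`) and puts positive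
mass on every consistent point, there is an underlying distribution `P` on
`X × Z × W × R_X × R_Z` satisfying `X ⟂ R_X | (Z, W, R_Z)` whose masked distribution is
exactly `Q`.  Hence `X ⟂ R_X | (Z, W, R_Z)` has no testable implications. -/
theorem self_masking_independence_untestable
    {X Z W : Type*} [Fintype X] [Nonempty X] [Fintype Z] [Nonempty Z]
    [Fintype W] [Nonempty W]
    [MeasurableSpace X] [MeasurableSingletonClass X]
    [MeasurableSpace Z] [MeasurableSingletonClass Z]
    [MeasurableSpace W] [MeasurableSingletonClass W]
    (Q : Measure (Option X × Option Z × W × Bool × Bool)) [IsProbabilityMeasure Q]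
    -- Q-a.s., X* = none iff R_X = 1 and Z* = none iff R_Z = 1:
    (haeX : Q {q | ¬ (q.1 = none ↔ q.2.2.2.1 = true)} = 0)
    (haeZ : Q {q | ¬ (q.2.1 = none ↔ q.2.2.2.2 = true)} = 0)
    -- positive probability on every point consistent with the two constraints:
    (hpos : ∀ q : Option X × Option Z × W × Bool × Bool,
      (q.1 = none ↔ q.2.2.2.1 = true) → (q.2.1 = none ↔ q.2.2.2.2 = true) →
      0 < Q {q}) :
    ∃ P : Measure (X × Z × W × Bool × Bool), IsProbabilityMeasure P ∧
      -- X is conditionally independent of R_X given (Z, W, R_Z) under P: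
      (∀ (x : X) (rx : Bool) (z : Z) (w : W) (rz : Bool),
        cpr P ({p | p.1 = x} ∩ {p | p.2.2.2.1 = rx})
            {p | p.2.1 = z ∧ p.2.2.1 = w ∧ p.2.2.2.2 = rz} =
          cpr P {p | p.1 = x} {p | p.2.1 = z ∧ p.2.2.1 = w ∧ p.2.2.2.2 = rz} *
            cpr P {p | p.2.2.2.1 = rx} {p | p.2.1 = z ∧ p.2.2.1 = w ∧ p.2.2.2.2 = rz}) ∧
      P.map mask2 = Q := by
  classical
  obtain ⟨z₀⟩ := ‹Nonempty Z›
  have hfin : ∀ q, Q {q} ≠ ⊤ := fun q => measure_ne_top Q _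
  let g : Z → Bool → Option Z := fun z rz => if rz = false then some z else none
  let S : Option Z → W → Bool → ENNReal := fun z w rz => ∑ x, Q {(some x, z, w, false, rz)}
  have hS : ∀ z w rz, (z = none ↔ rz = true) → S z w rz ≠ 0 := by
    intro z w rz h h0
    obtain ⟨x⟩ := ‹Nonempty X›
    exact (hpos (some x, z, w, false, rz) (by simp) h).ne'
      (Finset.sum_eq_zero_iff.1 h0 x (Finset.mem_univ x))
  have hS' : ∀ z w rz, S z w rz ≠ ⊤ := fun z w rz => ENNReal.sum_ne_top.2 fun x _ => hfin _
  have hg : ∀ z rz, g z rz = none ↔ rz = true := by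
    intro z rz
    cases rz <;> simp [g]
  -- Put all mass of the masked `Z` at `z₀`, and copy the law of `X` from `R_X = 0` to `R_X = 1`.
  let α : Z × W × Bool → X → ENNReal := fun c x =>
    if c.2.2 = true ∧ c.1 ≠ z₀ then 0 else Q {(some x, g c.1 c.2.2, c.2.1, false, c.2.2)}
  let β : Z × W × Bool → Bool → ENNReal := fun c rx =>
    if rx = true then
      Q {(none, g c.1 c.2.2, c.2.1, true, c.2.2)} / S (g c.1 c.2.2) c.2.1 c.2.2
    else 1
  have hα : ∀ c x, α c x ≠ ⊤ := by
    intro c x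
    dsimp only [α]
    split_ifs
    exacts [ENNReal.zero_ne_top, hfin _]
  have hβ : ∀ c r, β c r ≠ ⊤ := by
    intro c r
    dsimp only [β]
    split_ifs
    exacts [ENNReal.div_ne_top (hfin _) (hS _ _ _ (hg _ _)), ENNReal.one_ne_top]
  let P : Measure (X × Z × W × Bool × Bool) := massMeasure fun p =>
    α (p.2.1, p.2.2.1, p.2.2.2.2) p.1 * β (p.2.1, p.2.2.1, p.2.2.2.2) p.2.2.2.1
  have hmap : P.map mask2 = Q := by
    refine Measure.ext_of_singleton fun q => ?_
    rw [Measure.map_apply (measurable_of_countable _) (measurableSet_singleton q)]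
    by_cases hqX : q.1 = none ↔ q.2.2.2.1 = true
    swap
    · rw [measure_mono_null (Set.singleton_subset_iff.2 hqX) haeX]
      convert measure_empty (μ := P)
      refine Set.eq_empty_of_forall_notMem fun p hp => hqX ?_
      rw [← Set.mem_singleton_iff.1 hp]
      simp [mask2]
    by_cases hqZ : q.2.1 = none ↔ q.2.2.2.2 = true
    swap
    · rw [measure_mono_null (Set.singleton_subset_iff.2 hqZ) haeZ]
      convert measure_empty (μ := P)
      refine Set.eq_empty_of_forall_notMem fun p hp => hqZ ?_
      rw [← Set.mem_singleton_iff.1 hp]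
      simp [mask2]
    have hcancel : ∀ z w rz, (z = none ↔ rz = true) → ∀ b,
        ∑ x, Q {(some x, z, w, false, rz)} * (b / S z w rz) = b := by
      intro z w rz h b
      rw [← Finset.sum_mul]
      exact ENNReal.mul_div_cancel (hS z w rz h) (hS' z w rz)
    obtain ⟨x, z, w, rx, rz⟩ := q
    rcases rx <;> rcases rz <;> rcases x with _ | x <;> rcases z with _ | z <;>
      simp at hqX hqZ
    all_goals
      simp [P, massMeasure_apply, Fintype.sum_prod_type, mask2, ite_and, α, β, g,
        Finset.sum_ite_irrel]
    all_goals exact hcancel _ _ _ (by simp) _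
  have hP : IsProbabilityMeasure P := by
    refine ⟨?_⟩
    rw [← Set.preimage_univ (f := mask2), ← Measure.map_apply (measurable_of_countable _)
      MeasurableSet.univ, hmap, measure_univ]
  exact ⟨P, hP, cpr_inter_massMeasure α β hα hβ, hmap⟩
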